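/- Consider distributed stochastic convex optimization over a compact convex set W ⊆ ℝ^d with 0 ∈ W and diameter at most D: f = (1/n) Σ_{i=1}^n f_i with each f_i : W → ℝ convex, and at any query point each learner i receives a stochastic subgradient g_i with E[g_i] ∈ ∂f_i and ‖g_i‖ ≤ G almost surely. Run the distributed anytime online-to-batch conversion with D-FTCL and FCC: set L = ⌈1/δ⌉, K ≥ 1, η = D/(G√K), w¹ = 0, e_i¹ = 0, ê¹ = 0; at each iteration t = 1,…,K: x^t = (1/t) Σ_{k=1}^t w^k; each learner queries g_i^t at x^t; v_i^t = FCC(e_i^t + g_i^t, C, L), e_i^{t+1} = e_i^t + g_i^t − v_i^t; v^t = (1/n) Σ_i v_i^t; s^t = FCC(ê^t + v^t, C, L), ê^{t+1} = ê^t + v^t − s^t; w^{t+1} = argmin_{w∈W} ⟨Σ_{k=1}^t s^k, w⟩ + (1/η)‖w‖². Then for every x ∈ W, E[f(x^K) − f(x)] ≤ 20 D G / √K; in particular, with total communication rounds T = KL and L ≤ 2/δ, E[f(x^K) − f(x)] ≤ 29 D G / √(δT). -/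

import Mathlib

open MeasureTheory Real
open scoped ENNReal NNReal BigOperators RealInnerProductSpace

section Deterministic

variable {E : Type*} [NormedAddCommGroup E] [InnerProductSpace ℝ E]

/-- A minimizer of a linear functional plus a quadratic regularizer over a convex set
satisfies the quadratic growth inequality. -/
lemma quadratic_growth_of_regularized_min {W : Set E} (hW : Convex ℝ W) {c : ℝ}
    {p a b : E} (ha : a ∈ W) (hb : b ∈ W)
    (hmin : ∀ u ∈ W, ⟪p, a⟫ + c * ‖a‖ ^ 2 ≤ ⟪p, u⟫ + c * ‖u‖ ^ 2) :
    ⟪p, a⟫ + c * ‖a‖ ^ 2 + c * ‖a - b‖ ^ 2 ≤ ⟪p, b⟫ + c * ‖b‖ ^ 2 := by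
  have key : ∀ l : ℝ, 0 < l → l ≤ 1 →
      (1 - l) * (c * ‖a - b‖ ^ 2) ≤ ⟪p, b⟫ + c * ‖b‖ ^ 2 - (⟪p, a⟫ + c * ‖a‖ ^ 2) := by
    intro l hl0 hl1
    have h := hmin ((1 - l) • a + l • b) (hW ha hb (by linarith) hl0.le (by ring))
    have h1 : ‖(1 - l) • a + l • b‖ ^ 2
        = (1 - l) * ‖a‖ ^ 2 + l * ‖b‖ ^ 2 - l * (1 - l) * ‖a - b‖ ^ 2 := by
      rw [norm_add_sq_real, norm_sub_sq_real, norm_smul, norm_smul, inner_smul_left,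
        inner_smul_right, mul_pow, mul_pow, Real.norm_eq_abs, Real.norm_eq_abs, sq_abs, sq_abs]
      simp
      ring
    rw [h1, inner_add_right, inner_smul_right, inner_smul_right] at h
    refine le_of_mul_le_mul_left ?_ hl0
    linarith
  by_contra! hlt
  set X := ⟪p, b⟫ + c * ‖b‖ ^ 2 - (⟪p, a⟫ + c * ‖a‖ ^ 2) with hX
  set Y := c * ‖a - b‖ ^ 2 with hY
  have hX0 : 0 ≤ X := sub_nonneg.2 (hmin b hb)
  have hXY : X < Y := by linarith
  have hY0 : 0 < Y := hX0.trans_lt hXY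
  have h := key ((Y - X) / (2 * Y)) (by apply div_pos <;> linarith)
    ((div_le_one (by linarith)).2 (by linarith))
  have h2 : (1 - (Y - X) / (2 * Y)) * Y = (Y + X) / 2 := by field_simp; ring
  linarith

/-- Minimizers of regularized linear functionals are Lipschitz in the functional. -/
lemma norm_sub_le_of_regularized_min {W : Set E} (hW : Convex ℝ W) {c : ℝ} (hc : 0 < c)
    {p q a b : E} (ha : a ∈ W) (hb : b ∈ W)
    (hmina : ∀ u ∈ W, ⟪p, a⟫ + c * ‖a‖ ^ 2 ≤ ⟪p, u⟫ + c * ‖u‖ ^ 2)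
    (hminb : ∀ u ∈ W, ⟪q, b⟫ + c * ‖b‖ ^ 2 ≤ ⟪q, u⟫ + c * ‖u‖ ^ 2) :
    ‖a - b‖ ≤ ‖p - q‖ / (2 * c) := by
  have h1 := quadratic_growth_of_regularized_min hW ha hb hmina
  have h2 := quadratic_growth_of_regularized_min hW hb ha hminb
  rw [norm_sub_rev b a] at h2
  have h3 : ⟪p - q, b - a⟫ ≤ ‖p - q‖ * ‖a - b‖ := by
    rw [norm_sub_rev a b]; exact real_inner_le_norm _ _
  simp only [inner_sub_left, inner_sub_right] at h3
  rw [le_div_iff₀ (by positivity)]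
  rcases (norm_nonneg (a - b)).eq_or_lt with h | h
  · rw [← h]; simp
  · refine le_of_mul_le_mul_right ?_ h
    nlinarith

/-- The be-the-leader inequality for regularized linear losses. -/
lemma be_the_leader {W : Set E} {c : ℝ} (hc : 0 < c) (g y : ℕ → E)
    (hyW : ∀ t, y t ∈ W)
    (hy : ∀ t, ∀ u ∈ W, ⟪∑ k ∈ Finset.Icc 1 t, g k, y t⟫ + c * ‖y t‖ ^ 2
      ≤ ⟪∑ k ∈ Finset.Icc 1 t, g k, u⟫ + c * ‖u‖ ^ 2) (T : ℕ) :
    ∀ u ∈ W, ∑ t ∈ Finset.Icc 1 T, ⟪g t, y t⟫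
      ≤ ⟪∑ k ∈ Finset.Icc 1 T, g k, u⟫ + c * ‖u‖ ^ 2 := by
  induction T with
  | zero => intro u _; simp; positivity
  | succ T ih =>
    intro u hu
    refine le_trans ?_ (hy (T + 1) u hu)
    have h := ih (y (T + 1)) (hyW _)
    rw [Finset.sum_Icc_succ_top (by omega), Finset.sum_Icc_succ_top (by omega), inner_add_left]
    linarith

/-- Regret of follow-the-regularized-leader run on surrogate losses `s` in place of `g`. -/
lemma ftrl_regret_of_surrogate {W : Set E} (hWcpt : IsCompact W) (hW : Convex ℝ W)
    {c : ℝ} (hc : 0 < c) (g s w : ℕ → E) (K : ℕ)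
    (hwW : ∀ t ∈ Finset.Icc 1 K, w t ∈ W)
    (hw : ∀ t ∈ Finset.Icc 1 K, ∀ u ∈ W,
      ⟪∑ k ∈ Finset.Icc 1 (t - 1), s k, w t⟫ + c * ‖w t‖ ^ 2
        ≤ ⟪∑ k ∈ Finset.Icc 1 (t - 1), s k, u⟫ + c * ‖u‖ ^ 2)
    {u : E} (hu : u ∈ W) :
    ∑ t ∈ Finset.Icc 1 K, ⟪g t, w t - u⟫ ≤ c * ‖u‖ ^ 2 +
      ∑ t ∈ Finset.Icc 1 K,
        ‖g t‖ * (‖g t‖ + ‖∑ k ∈ Finset.Icc 1 (t - 1), (g k - s k)‖) / (2 * c) := by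
  have hex : ∀ t : ℕ, ∃ y ∈ W, ∀ u ∈ W, ⟪∑ k ∈ Finset.Icc 1 t, g k, y⟫ + c * ‖y‖ ^ 2
      ≤ ⟪∑ k ∈ Finset.Icc 1 t, g k, u⟫ + c * ‖u‖ ^ 2 := fun t =>
    hWcpt.exists_isMinOn ⟨u, hu⟩
      (f := fun z => ⟪∑ k ∈ Finset.Icc 1 t, g k, z⟫ + c * ‖z‖ ^ 2) (by fun_prop)
  choose y hyW hy using hex
  have hbtl := be_the_leader hc g y hyW hy K u hu
  have hterm : ∀ t ∈ Finset.Icc 1 K, ⟪g t, w t⟫ ≤ ⟪g t, y t⟫ +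
      ‖g t‖ * (‖g t‖ + ‖∑ k ∈ Finset.Icc 1 (t - 1), (g k - s k)‖) / (2 * c) := by
    intro t ht
    have ht1 : 1 ≤ t := (Finset.mem_Icc.1 ht).1
    have h1 := norm_sub_le_of_regularized_min hW hc (hyW (t - 1)) (hyW t) (hy (t - 1)) (hy t)
    have h2 := norm_sub_le_of_regularized_min hW hc (hwW t ht) (hyW (t - 1)) (hw t ht)
      (hy (t - 1))
    have h3 : ∑ k ∈ Finset.Icc 1 (t - 1), g k - ∑ k ∈ Finset.Icc 1 t, g k = -g t := by
      obtain ⟨r, rfl⟩ : ∃ r, t = r + 1 := ⟨t - 1, by omega⟩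
      rw [Finset.sum_Icc_succ_top (by omega)]
      simp
    rw [h3, norm_neg] at h1
    rw [norm_sub_rev (∑ k ∈ Finset.Icc 1 (t - 1), s k), ← Finset.sum_sub_distrib] at h2
    have h4 : ‖w t - y t‖ ≤ ‖w t - y (t - 1)‖ + ‖y (t - 1) - y t‖ :=
      norm_sub_le_norm_sub_add_norm_sub _ _ _
    have h5 : ⟪g t, w t - y t⟫ ≤ ‖g t‖ * ‖w t - y t‖ := real_inner_le_norm _ _
    have h6 : ‖g t‖ * ‖w t - y t‖
        ≤ ‖g t‖ * ((‖g t‖ + ‖∑ k ∈ Finset.Icc 1 (t - 1), (g k - s k)‖) / (2 * c)) := by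
      gcongr
      rw [add_div]
      linarith
    rw [inner_sub_right] at h5
    rw [mul_div_assoc]
    linarith
  have hsum := Finset.sum_le_sum hterm
  simp only [inner_sub_right, Finset.sum_sub_distrib, Finset.sum_add_distrib] at hsum ⊢
  rw [← sum_inner]
  linarith

/-- The anytime online-to-batch conversion: subgradients queried at running averages turn
regret into a last-iterate guarantee. -/
lemma anytime_online_to_batch {W : Set E} (hW : Convex ℝ W) (f : E → ℝ) (w x h : ℕ → E) (K : ℕ)
    (hwW : ∀ t ∈ Finset.Icc 1 K, w t ∈ W)
    (hx : ∀ t, 1 ≤ t → x t = (t : ℝ)⁻¹ • ∑ k ∈ Finset.Icc 1 t, w k)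
    (hh : ∀ t ∈ Finset.Icc 1 K, ∀ u ∈ W, f (x t) + ⟪h t, u - x t⟫ ≤ f u)
    {u : E} (hu : u ∈ W) :
    K * (f (x K) - f u) ≤ ∑ t ∈ Finset.Icc 1 K, ⟪h t, w t - u⟫ := by
  have hxW : ∀ t ∈ Finset.Icc 1 K, x t ∈ W := by
    intro t ht
    obtain ⟨ht1, htK⟩ := Finset.mem_Icc.1 ht
    rw [hx t ht1, Finset.smul_sum]
    refine hW.sum_mem (fun _ _ => by positivity) ?_ fun k hk => hwW k ?_
    · have : (t : ℝ) ≠ 0 := by positivity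
      simp [this]
    · simp only [Finset.mem_Icc] at hk ⊢; omega
  have main : ∀ T ≤ K, T * (f (x T) - f u) ≤ ∑ t ∈ Finset.Icc 1 T, ⟪h t, w t - u⟫ := by
    intro T
    induction T with
    | zero => simp
    | succ T ih =>
      intro hT
      have ih := ih (by omega)
      have hmem : T + 1 ∈ Finset.Icc 1 K := by simp; omega
      have hsub := hh (T + 1) hmem u hu
      have hstep : (T : ℝ) * (f (x (T + 1)) - f (x T))
          ≤ ⟪h (T + 1), w (T + 1) - x (T + 1)⟫ := by
        have hrec : w (T + 1) - x (T + 1) = (T : ℝ) • (x (T + 1) - x T) := by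
          have h1 : ((T : ℝ) + 1) • x (T + 1) = ∑ k ∈ Finset.Icc 1 (T + 1), w k := by
            rw [hx (T + 1) (by omega), smul_smul]
            have : ((T : ℝ) + 1) ≠ 0 := by positivity
            push_cast
            rw [mul_inv_cancel₀ this, one_smul]
          have h2 : (T : ℝ) • x T = ∑ k ∈ Finset.Icc 1 T, w k := by
            rcases Nat.eq_zero_or_pos T with rfl | h0
            · simp
            · rw [hx T h0, smul_smul, mul_inv_cancel₀ (by positivity), one_smul]
          rw [Finset.sum_Icc_succ_top (by omega), ← h2, add_smul, one_smul] at h1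
          rw [smul_sub, sub_eq_sub_iff_add_eq_add, h1]
          abel
        rw [hrec, inner_smul_right]
        rcases Nat.eq_zero_or_pos T with rfl | h0
        · simp
        · have h3 := hh (T + 1) hmem (x T) (hxW T (by simp; omega))
          rw [← neg_sub, inner_neg_right] at h3
          gcongr
          linarith
      rw [Finset.sum_Icc_succ_top (by omega)]
      simp only [inner_sub_right] at *
      push_cast
      linarith
  exact main K le_rfl

end Deterministic

section Stochastic

variable {Ω : Type*} [MeasurableSpace Ω] {μ : Measure Ω}
  {E : Type*} [NormedAddCommGroup E]

/-- A second-moment contraction, expressed through the `L²` seminorm. -/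
lemma eLpNorm_two_le_of_lintegral_sq_le {f h : Ω → E} {a : ℝ} {q : ℝ≥0∞}
    (ha : ENNReal.ofReal a ≤ q ^ 2)
    (hfh : ∫⁻ ω, (‖f ω‖₊ : ℝ≥0∞) ^ 2 ∂μ
      ≤ ENNReal.ofReal a * ∫⁻ ω, (‖h ω‖₊ : ℝ≥0∞) ^ 2 ∂μ) :
    eLpNorm f 2 μ ≤ q * eLpNorm h 2 μ := by
  have hsq : ∀ k : Ω → E, eLpNorm k 2 μ ^ 2 = ∫⁻ ω, (‖k ω‖₊ : ℝ≥0∞) ^ 2 ∂μ := by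
    intro k
    have := eLpNorm_nnreal_pow_eq_lintegral (μ := μ) (f := k) (p := 2) (by norm_num)
    norm_num at this
    exact this
  refine (ENNReal.pow_le_pow_left_iff two_ne_zero).1 ?_
  rw [mul_pow, hsq, hsq]
  exact hfh.trans (by gcongr)

/-- Bounds on the error and message sequences of error feedback with a compressor that
contracts `L²` norms by a factor `2 / 3`. -/
lemma error_feedback_bounds (a v err : ℕ → Ω → E) (K : ℕ) (B : ℝ≥0∞)
    (ha : ∀ t, AEStronglyMeasurable (a t) μ) (hv : ∀ t, AEStronglyMeasurable (v t) μ)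
    (herr1 : err 1 = fun _ => 0)
    (hrec : ∀ t, 1 ≤ t → ∀ ω, err (t + 1) ω = err t ω + a t ω - v t ω)
    (haB : ∀ t ∈ Finset.Icc 1 K, eLpNorm (a t) 2 μ ≤ B)
    (hcontr : ∀ t ∈ Finset.Icc 1 K,
      eLpNorm (fun ω => v t ω - (err t ω + a t ω)) 2 μ
        ≤ 2 / 3 * eLpNorm (fun ω => err t ω + a t ω) 2 μ) :
    (∀ t, 1 ≤ t → AEStronglyMeasurable (err t) μ) ∧
    (∀ t ∈ Finset.Icc 1 (K + 1), eLpNorm (err t) 2 μ ≤ 2 * B) ∧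
    (∀ t ∈ Finset.Icc 1 K, eLpNorm (v t) 2 μ ≤ 5 * B) := by
  have hm : ∀ t, 1 ≤ t → AEStronglyMeasurable (err t) μ := by
    intro t ht
    induction t, ht using Nat.le_induction with
    | base => rw [herr1]; exact aestronglyMeasurable_const
    | succ t ht ih =>
      rw [funext (hrec t ht)]
      exact (ih.add (ha t)).sub (hv t)
  have hin : ∀ t ∈ Finset.Icc 1 K, eLpNorm (err t) 2 μ ≤ 2 * B →
      eLpNorm (fun ω => err t ω + a t ω) 2 μ ≤ 3 * B := by
    intro t ht h
    refine (eLpNorm_add_le (hm t (Finset.mem_Icc.1 ht).1) (ha t) one_le_two).trans ?_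
    calc _ ≤ 2 * B + B := add_le_add h (haB t ht)
      _ = 3 * B := by ring
  have hE : ∀ t, 1 ≤ t → t ≤ K + 1 → eLpNorm (err t) 2 μ ≤ 2 * B := by
    intro t ht
    induction t, ht using Nat.le_induction with
    | base => intro _; rw [herr1]; simp
    | succ t ht ih =>
      intro htK
      have htm : t ∈ Finset.Icc 1 K := by simp; omega
      have h1 : err (t + 1) = -fun ω => v t ω - (err t ω + a t ω) := by
        funext ω; simp [hrec t ht ω]
      rw [h1, eLpNorm_neg]
      calc _ ≤ 2 / 3 * (3 * B) := (hcontr t htm).trans (by gcongr; exact hin t htm (ih (by omega)))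
        _ = 2 * B := by
          rw [← mul_assoc, ENNReal.div_mul_cancel (by norm_num) (by norm_num)]
  refine ⟨hm, fun t ht => hE t (Finset.mem_Icc.1 ht).1 (Finset.mem_Icc.1 ht).2, fun t ht => ?_⟩
  obtain ⟨ht1, htK⟩ := Finset.mem_Icc.1 ht
  have h1 : v t = (fun ω => err t ω + a t ω) - err (t + 1) := by
    funext ω; simp [hrec t ht1 ω]
  rw [h1]
  refine (eLpNorm_sub_le ((hm t ht1).add (ha t)) (hm (t + 1) (by omega)) one_le_two).trans ?_
  calc _ ≤ 3 * B + 2 * B := add_le_add (hin t ht (hE t ht1 (by omega)))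
        (hE (t + 1) (by omega) (by omega))
    _ = 5 * B := by ring

/-- The `L²` seminorm of an average is at most a common bound on the `L²` seminorms. -/
lemma eLpNorm_two_average_le [NormedSpace ℝ E] {n : ℕ} (hn : 1 ≤ n) (h : ℕ → Ω → E) (B : ℝ≥0∞)
    (hm : ∀ i ∈ Finset.Icc 1 n, AEStronglyMeasurable (h i) μ)
    (hB : ∀ i ∈ Finset.Icc 1 n, eLpNorm (h i) 2 μ ≤ B) :
    eLpNorm (fun ω => (n : ℝ)⁻¹ • ∑ i ∈ Finset.Icc 1 n, h i ω) 2 μ ≤ B := by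
  have h1 : (fun ω => (n : ℝ)⁻¹ • ∑ i ∈ Finset.Icc 1 n, h i ω)
      = (n : ℝ)⁻¹ • ∑ i ∈ Finset.Icc 1 n, h i := by
    funext ω; simp
  rw [h1, eLpNorm_const_smul]
  have h2 : eLpNorm (∑ i ∈ Finset.Icc 1 n, h i) 2 μ ≤ n * B := by
    refine (eLpNorm_sum_le hm one_le_two).trans ?_
    refine (Finset.sum_le_sum hB).trans ?_
    simp
  have h3 : ‖(n : ℝ)⁻¹‖ₑ = (n : ℝ≥0∞)⁻¹ := by
    have : (n : ℝ) ≠ 0 := by positivity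
    rw [enorm_inv this]
    simp
  rw [h3]
  calc _ ≤ (n : ℝ≥0∞)⁻¹ * (n * B) := by gcongr
    _ = B := by
      rw [← mul_assoc, ENNReal.inv_mul_cancel (by simp; omega) (by simp), one_mul]

/-- An `L²` bound on a probability space gives integrability and an `L¹` bound. -/
lemma integrable_and_integral_norm_le_of_eLpNorm_two_le [IsProbabilityMeasure μ] {h : Ω → E}
    (hm : AEStronglyMeasurable h μ) {B : ℝ} (hB : 0 ≤ B)
    (hh : eLpNorm h 2 μ ≤ ENNReal.ofReal B) :
    Integrable h μ ∧ ∫ ω, ‖h ω‖ ∂μ ≤ B := by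
  have h1 : eLpNorm h 1 μ ≤ ENNReal.ofReal B :=
    (eLpNorm_le_eLpNorm_of_exponent_le one_le_two hm).trans hh
  refine ⟨memLp_one_iff_integrable.1 ⟨hm, h1.trans_lt ENNReal.ofReal_lt_top⟩, ?_⟩
  rw [integral_norm_eq_lintegral_enorm hm, ← eLpNorm_one_eq_lintegral_enorm]
  exact ENNReal.toReal_le_of_le_ofReal hB h1

end Stochastic

/-- After `⌈1 / δ⌉` rounds the contraction factor is at most `4 / 9`. -/
lemma one_sub_pow_ceil_le {δ : ℝ} (h0 : 0 < δ) (h1 : δ ≤ 1) :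
    (1 - δ) ^ ⌈1 / δ⌉₊ ≤ 4 / 9 := by
  have hL : 1 ≤ δ * (⌈1 / δ⌉₊ : ℝ) := by
    have := Nat.le_ceil (1 / δ)
    rwa [div_le_iff₀ h0, mul_comm] at this
  calc (1 - δ) ^ ⌈1 / δ⌉₊ ≤ (Real.exp (-δ)) ^ ⌈1 / δ⌉₊ :=
        pow_le_pow_left₀ (by linarith) (Real.one_sub_le_exp_neg δ) _
    _ = Real.exp (-(δ * ⌈1 / δ⌉₊)) := by rw [← Real.exp_nat_mul]; ring_nf
    _ ≤ Real.exp (-1) := Real.exp_le_exp.2 (by linarith)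
    _ ≤ 4 / 9 := by
      have := Real.exp_neg_one_lt_d9
      linarith

/-- distributed anytime online-to-batch conversion with compressed
communication, convex case. Over a compact convex domain `W ∋ 0` of diameter at most `D`,
with `f = (1/n) Σ_i f_i`, each `f_i` convex on `W`, run the distributed anytime
online-to-batch conversion with D-FTCL and `L = ⌈1/δ⌉`-round fast compressed communication
(FCC), uniform weights, and `η = D/(G√K)`: `w¹ = 0`, `x^t = (1/t) Σ_{k≤t} w^k`, each
learner queries a stochastic subgradient `g_i^t` at `x^t` (`‖g_i^t‖ ≤ G` a.s., and the
conditional mean `ĝ_i^t` of `g_i^t` given the past is a.s. a subgradient of `f_i` at `x^t`),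
the messages are produced by FCC with error feedback on both sides, and
`w^{t+1} = argmin_{w ∈ W} ⟨Σ_{k=1}^t s^k, w⟩ + (1/η)‖w‖²`. Then for every `x ∈ W`,
`E[f(x^K) − f(x)] ≤ 20DG/√K`; in particular, with total communication rounds `T = KL` and
since `L ≤ 2/δ`, `E[f(x^K) − f(x)] ≤ 29DG/√(δT)`.

The past is modelled by a filtration `ℱ`: `x^t` and `w^t` are `ℱ_{t−1}`-measurable, and the
FCC guarantee `E[‖FCC(x,C,L) − x‖²] ≤ (1−δ)^L E[‖x‖²]` for inputs depending only on past
invocations is encoded by `hFCClearner` and `hFCCserver`. -/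
theorem distributed_o2b_convex
    {d n K : ℕ} (hn : 1 ≤ n) (hK : 1 ≤ K)
    {Ω : Type*} [m0 : MeasurableSpace Ω] (μpr : Measure Ω) [IsProbabilityMeasure μpr]
    (ℱ : ℕ → MeasurableSpace Ω) (hle : ∀ t, ℱ t ≤ m0) (hmono : Monotone ℱ)
    (W : Set (EuclideanSpace ℝ (Fin d)))
    (hWcpt : IsCompact W) (hWconv : Convex ℝ W)
    (hW0 : (0 : EuclideanSpace ℝ (Fin d)) ∈ W)
    (D G δ η : ℝ) (hD : 0 < D) (hG : 0 < G) (hδ0 : 0 < δ) (hδ1 : δ ≤ 1)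
    (hdiam : ∀ x ∈ W, ∀ y ∈ W, ‖x - y‖ ≤ D)
    (L : ℕ) (hL : L = ⌈1 / δ⌉₊)
    (f : ℕ → EuclideanSpace ℝ (Fin d) → ℝ)
    (hconv : ∀ i ∈ Finset.Icc 1 n, ConvexOn ℝ W (f i))
    (w x : ℕ → Ω → EuclideanSpace ℝ (Fin d))
    (g ghat v e : ℕ → ℕ → Ω → EuclideanSpace ℝ (Fin d))
    (vbar s ehat : ℕ → Ω → EuclideanSpace ℝ (Fin d))
    (hmw : ∀ t, Measurable (w t)) (hmg : ∀ i t, Measurable (g i t))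
    (hmv : ∀ i t, Measurable (v i t)) (hms : ∀ t, Measurable (s t))
    (hwF : ∀ t ∈ Finset.Icc 1 K, Measurable[ℱ (t - 1)] (w t))
    (hw1 : w 1 = fun _ => 0)
    (hxdef : ∀ t, 1 ≤ t → ∀ ω, x t ω = (t : ℝ)⁻¹ • ∑ k ∈ Finset.Icc 1 t, w k ω)
    (hgbound : ∀ i ∈ Finset.Icc 1 n, ∀ t ∈ Finset.Icc 1 K,
      ∀ᵐ ω ∂μpr, ‖g i t ω‖ ≤ G)
    (hcond : ∀ i ∈ Finset.Icc 1 n, ∀ t ∈ Finset.Icc 1 K,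
      μpr[g i t|ℱ (t - 1)] =ᵐ[μpr] ghat i t)
    (hsubgrad : ∀ i ∈ Finset.Icc 1 n, ∀ t ∈ Finset.Icc 1 K,
      ∀ᵐ ω ∂μpr, ∀ u ∈ W, f i (x t ω) + ⟪ghat i t ω, u - x t ω⟫ ≤ f i u)
    (he1 : ∀ i, e i 1 = fun _ => 0)
    (hehat1 : ehat 1 = fun _ => 0)
    (herec : ∀ i, ∀ t, 1 ≤ t → ∀ ω, e i (t + 1) ω = e i t ω + g i t ω - v i t ω)
    (hvbar : ∀ t ω, vbar t ω = (n : ℝ)⁻¹ • ∑ i ∈ Finset.Icc 1 n, v i t ω)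
    (hehatrec : ∀ t, 1 ≤ t → ∀ ω, ehat (t + 1) ω = ehat t ω + vbar t ω - s t ω)
    (hFCClearner : ∀ i ∈ Finset.Icc 1 n, ∀ t ∈ Finset.Icc 1 K,
      ∫⁻ ω, (‖v i t ω - (e i t ω + g i t ω)‖₊ : ℝ≥0∞) ^ 2 ∂μpr
        ≤ ENNReal.ofReal ((1 - δ) ^ L) *
          ∫⁻ ω, (‖e i t ω + g i t ω‖₊ : ℝ≥0∞) ^ 2 ∂μpr)
    (hFCCserver : ∀ t ∈ Finset.Icc 1 K,
      ∫⁻ ω, (‖s t ω - (ehat t ω + vbar t ω)‖₊ : ℝ≥0∞) ^ 2 ∂μpr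
        ≤ ENNReal.ofReal ((1 - δ) ^ L) *
          ∫⁻ ω, (‖ehat t ω + vbar t ω‖₊ : ℝ≥0∞) ^ 2 ∂μpr)
    (hupdateW : ∀ t ∈ Finset.Icc 1 K, ∀ ω, w (t + 1) ω ∈ W)
    (hupdate : ∀ t ∈ Finset.Icc 1 K, ∀ ω, ∀ u ∈ W,
      ⟪∑ k ∈ Finset.Icc 1 t, s k ω, w (t + 1) ω⟫ + (1 / η) * ‖w (t + 1) ω‖ ^ 2
        ≤ ⟪∑ k ∈ Finset.Icc 1 t, s k ω, u⟫ + (1 / η) * ‖u‖ ^ 2)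
    (hη : η = D / (G * Real.sqrt K)) :
    ∀ u ∈ W,
      (∫ ω, ((n : ℝ)⁻¹ * ∑ i ∈ Finset.Icc 1 n, (f i (x K ω) - f i u)) ∂μpr
          ≤ 20 * D * G / Real.sqrt K) ∧
        ∫ ω, ((n : ℝ)⁻¹ * ∑ i ∈ Finset.Icc 1 n, (f i (x K ω) - f i u)) ∂μpr
          ≤ 29 * D * G / Real.sqrt (δ * ((K : ℝ) * (L : ℝ))) := by
  have hn0 : (0 : ℝ) < n := by exact_mod_cast hn
  have hK0 : (0 : ℝ) < K := by exact_mod_cast hK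
  have hsK : 0 < √(K : ℝ) := Real.sqrt_pos.2 hK0
  have hη0 : 0 < η := by rw [hη]; positivity
  have hc : 0 < 1 / η := by positivity
  have hwW : ∀ t ∈ Finset.Icc 1 K, ∀ ω, w t ω ∈ W := by
    intro t ht ω
    obtain ⟨ht1, htK⟩ := Finset.mem_Icc.1 ht
    obtain ⟨r, rfl⟩ : ∃ r, t = r + 1 := ⟨t - 1, by omega⟩
    rcases Nat.eq_zero_or_pos r with rfl | hr
    · simpa [hw1] using hW0
    · exact hupdateW r (by simp; omega) ω
  have hwmin : ∀ t ∈ Finset.Icc 1 K, ∀ ω, ∀ u ∈ W,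
      ⟪∑ k ∈ Finset.Icc 1 (t - 1), s k ω, w t ω⟫ + (1 / η) * ‖w t ω‖ ^ 2
        ≤ ⟪∑ k ∈ Finset.Icc 1 (t - 1), s k ω, u⟫ + (1 / η) * ‖u‖ ^ 2 := by
    intro t ht ω u hu
    obtain ⟨ht1, htK⟩ := Finset.mem_Icc.1 ht
    obtain ⟨r, rfl⟩ : ∃ r, t = r + 1 := ⟨t - 1, by omega⟩
    rcases Nat.eq_zero_or_pos r with rfl | hr
    · simp [hw1]; positivity
    · exact hupdate r (by simp; omega) ω u hu
  have hfac : ENNReal.ofReal ((1 - δ) ^ L) ≤ (2 / 3 : ℝ≥0∞) ^ 2 := by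
    have h1 : (2 / 3 : ℝ≥0∞) ^ 2 = ENNReal.ofReal (4 / 9) := by
      have h2 : (2 / 3 : ℝ≥0∞) = ENNReal.ofReal (2 / 3) := by
        rw [ENNReal.ofReal_div_of_pos (by norm_num)]; simp
      rw [h2, ← ENNReal.ofReal_pow (by norm_num)]
      norm_num
    rw [h1, hL]
    exact ENNReal.ofReal_le_ofReal (one_sub_pow_ceil_le hδ0 hδ1)
  have hgL2 : ∀ i ∈ Finset.Icc 1 n, ∀ t ∈ Finset.Icc 1 K,
      eLpNorm (g i t) 2 μpr ≤ ENNReal.ofReal G := by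
    intro i hi t ht
    simpa using eLpNorm_le_of_ae_bound (p := 2) (hgbound i hi t ht)
  have hlearner := fun i (hi : i ∈ Finset.Icc 1 n) =>
    error_feedback_bounds (μ := μpr) (g i) (v i) (e i) K (ENNReal.ofReal G)
      (fun t => (hmg i t).aestronglyMeasurable) (fun t => (hmv i t).aestronglyMeasurable)
      (he1 i) (herec i) (hgL2 i hi)
      (fun t ht => eLpNorm_two_le_of_lintegral_sq_le hfac (hFCClearner i hi t ht))
  have hvbarm : ∀ t, AEStronglyMeasurable (vbar t) μpr := by
    intro t
    rw [funext (hvbar t)]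
    exact (Measurable.const_smul (Finset.measurable_fun_sum _ fun i _ => hmv i t)
      (n : ℝ)⁻¹).aestronglyMeasurable
  have hserver := error_feedback_bounds (μ := μpr) vbar s ehat K (5 * ENNReal.ofReal G)
      hvbarm (fun t => (hms t).aestronglyMeasurable) hehat1 hehatrec
      (fun t ht => by
        rw [funext (hvbar t)]
        exact eLpNorm_two_average_le hn (fun i => v i t) _
          (fun i _ => (hmv i t).aestronglyMeasurable) (fun i hi => (hlearner i hi).2.2 t ht))
      (fun t ht => eLpNorm_two_le_of_lintegral_sq_le hfac (hFCCserver t ht))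
  set gbar : ℕ → Ω → EuclideanSpace ℝ (Fin d) :=
    fun t ω => (n : ℝ)⁻¹ • ∑ i ∈ Finset.Icc 1 n, g i t ω with hgbar
  set err : ℕ → Ω → EuclideanSpace ℝ (Fin d) :=
    fun t ω => ∑ k ∈ Finset.Icc 1 (t - 1), (gbar k ω - s k ω) with herr
  have herr_eq : ∀ t, 1 ≤ t → err t =
      ehat t + fun ω => (n : ℝ)⁻¹ • ∑ i ∈ Finset.Icc 1 n, e i t ω := by
    intro t ht
    induction t, ht using Nat.le_induction with
    | base => funext ω; simp [herr, hehat1, he1]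
    | succ t ht ih =>
      funext ω
      have h1 := congrFun ih ω
      have h2 : err (t + 1) ω = err t ω + (gbar t ω - s t ω) := by
        obtain ⟨r, rfl⟩ : ∃ r, t = r + 1 := ⟨t - 1, by omega⟩
        simp only [herr, Nat.add_sub_cancel]
        rw [Finset.sum_Icc_succ_top (by omega)]
      rw [h2, h1]
      simp only [Pi.add_apply, hehatrec t ht ω, herec _ t ht ω, hvbar, hgbar,
        Finset.sum_sub_distrib, Finset.sum_add_distrib, smul_sub, smul_add]
      abel
  have herr_bound : ∀ t ∈ Finset.Icc 1 K,
      Integrable (err t) μpr ∧ ∫ ω, ‖err t ω‖ ∂μpr ≤ 12 * G := by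
    intro t ht
    obtain ⟨ht1, htK⟩ := Finset.mem_Icc.1 ht
    have ht' : t ∈ Finset.Icc 1 (K + 1) := by simp; omega
    have hem : AEStronglyMeasurable
        (fun ω => (n : ℝ)⁻¹ • ∑ i ∈ Finset.Icc 1 n, e i t ω) μpr :=
      (Finset.aestronglyMeasurable_fun_sum _
        fun i hi => (hlearner i hi).1 t ht1).const_smul (n : ℝ)⁻¹
    refine integrable_and_integral_norm_le_of_eLpNorm_two_le ?_ (by positivity) ?_
    · rw [herr_eq t ht1]
      exact (hserver.1 t ht1).add hem
    · rw [herr_eq t ht1]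
      refine (eLpNorm_add_le (hserver.1 t ht1) hem one_le_two).trans ?_
      refine (add_le_add (hserver.2.1 t ht')
        (eLpNorm_two_average_le hn (fun i => e i t) (2 * ENNReal.ofReal G)
          (fun i hi => (hlearner i hi).1 t ht1)
          (fun i hi => (hlearner i hi).2.1 t ht'))).trans ?_
      rw [ENNReal.ofReal_mul (by norm_num)]
      norm_num
      ring_nf
      rfl
  have hgint : ∀ i ∈ Finset.Icc 1 n, ∀ t ∈ Finset.Icc 1 K, Integrable (g i t) μpr :=
    fun i hi t ht => Integrable.of_bound (hmg i t).aestronglyMeasurable G (hgbound i hi t ht)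
  have hghatint : ∀ i ∈ Finset.Icc 1 n, ∀ t ∈ Finset.Icc 1 K, Integrable (ghat i t) μpr :=
    fun i hi t ht => integrable_condExp.congr (hcond i hi t ht)
  intro u hu
  have hDw : ∀ t ∈ Finset.Icc 1 K, ∀ ω, ‖w t ω - u‖ ≤ D :=
    fun t ht ω => hdiam _ (hwW t ht ω) _ hu
  have hinnerint : ∀ t ∈ Finset.Icc 1 K, ∀ h : Ω → EuclideanSpace ℝ (Fin d),
      Integrable h μpr → Integrable (fun ω => ⟪h ω, w t ω - u⟫) μpr := by
    intro t ht h hh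
    refine (hh.norm.mul_const D).mono'
      (hh.1.inner ((hmw t).sub_const u).aestronglyMeasurable) (ae_of_all _ fun ω => ?_)
    rw [Real.norm_eq_abs]
    exact (abs_real_inner_le_norm _ _).trans (by gcongr; exact hDw t ht ω)
  have hunbiased : ∀ i ∈ Finset.Icc 1 n, ∀ t ∈ Finset.Icc 1 K,
      ∫ ω, ⟪ghat i t ω, w t ω - u⟫ ∂μpr = ∫ ω, ⟪g i t ω, w t ω - u⟫ ∂μpr := by
    intro i hi t ht
    have h1 : μpr[fun ω => ⟪g i t ω, w t ω - u⟫|ℱ (t - 1)]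
        =ᵐ[μpr] fun ω => ⟪(μpr[g i t|ℱ (t - 1)]) ω, w t ω - u⟫ :=
      condExp_bilin_of_aestronglyMeasurable_right (μ := μpr) (m := ℱ (t - 1))
      (innerSL ℝ) (f := g i t) (g := fun ω => w t ω - u)
      ((hwF t ht).sub_const u).stronglyMeasurable.aestronglyMeasurable
      (hinnerint t ht _ (hgint i hi t ht)) (hgint i hi t ht)
    rw [← integral_condExp (hle (t - 1)) (f := fun ω => ⟪g i t ω, w t ω - u⟫)]
    refine integral_congr_ae ?_
    filter_upwards [h1, hcond i hi t ht] with ω h2 h3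
    rw [h2, h3]
  have hgbarint : ∀ t ∈ Finset.Icc 1 K, Integrable (gbar t) μpr := fun t ht =>
    (integrable_finsetSum _ fun i hi => hgint i hi t ht).smul (n : ℝ)⁻¹
  have hregret : ∑ t ∈ Finset.Icc 1 K, ∫ ω, ⟪gbar t ω, w t ω - u⟫ ∂μpr
      ≤ 15 / 2 * D * G * √(K : ℝ) := by
    have hpt : ∀ᵐ ω ∂μpr, ∑ t ∈ Finset.Icc 1 K, ⟪gbar t ω, w t ω - u⟫
        ≤ 1 / η * D ^ 2 + ∑ t ∈ Finset.Icc 1 K, η / 2 * (G * (G + ‖err t ω‖)) := by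
      have hall : ∀ᵐ ω ∂μpr, ∀ i ∈ Finset.Icc 1 n, ∀ t ∈ Finset.Icc 1 K, ‖g i t ω‖ ≤ G :=
        (Finset.eventually_all _).2 fun i hi =>
          (Finset.eventually_all _).2 fun t ht => hgbound i hi t ht
      filter_upwards [hall] with ω hω
      have hgb : ∀ t ∈ Finset.Icc 1 K, ‖gbar t ω‖ ≤ G := by
        intro t ht
        have h1 : ‖∑ i ∈ Finset.Icc 1 n, g i t ω‖ ≤ n * G := by
          refine (norm_sum_le_of_le _ fun i hi => hω i hi t ht).trans ?_
          simp
        rw [hgbar, norm_smul, norm_inv, RCLike.norm_natCast, inv_mul_le_iff₀ hn0]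
        exact h1
      refine (ftrl_regret_of_surrogate hWcpt hWconv hc (fun t => gbar t ω) (fun t => s t ω)
        (fun t => w t ω) K (fun t ht => hwW t ht ω) (fun t ht => hwmin t ht ω) hu).trans ?_
      gcongr with t ht
      · simpa using hdiam u hu 0 hW0
      · have hg := hgb t ht
        calc _ = η / 2 * (‖gbar t ω‖ * (‖gbar t ω‖ + ‖err t ω‖)) := by
              simp only [herr]; field_simp
          _ ≤ _ := by gcongr
    have hterm : ∀ t ∈ Finset.Icc 1 K,
        Integrable (fun ω => η / 2 * (G * (G + ‖err t ω‖))) μpr := fun t ht =>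
      (((integrable_const G).add (herr_bound t ht).1.norm).const_mul G).const_mul _
    rw [← integral_finsetSum _ fun t ht => hinnerint t ht _ (hgbarint t ht)]
    refine (integral_mono_ae (integrable_finsetSum _
      fun t ht => hinnerint t ht _ (hgbarint t ht))
      ((integrable_const _).add (integrable_finsetSum _ hterm)) hpt).trans ?_
    simp only [Pi.add_apply]
    rw [integral_add (integrable_const _) (integrable_finsetSum _ hterm),
      integral_finsetSum _ hterm]
    have hti : ∀ t ∈ Finset.Icc 1 K,
        ∫ ω, η / 2 * (G * (G + ‖err t ω‖)) ∂μpr ≤ η / 2 * (G * (13 * G)) := by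
      intro t ht
      rw [integral_const_mul, integral_const_mul,
        integral_add (integrable_const _) (herr_bound t ht).1.norm]
      have := (herr_bound t ht).2
      gcongr
      simp
      linarith
    refine (add_le_add_right (Finset.sum_le_sum hti) _).trans (le_of_eq ?_)
    have hsq : (K : ℝ) = √(K : ℝ) * √(K : ℝ) := (Real.mul_self_sqrt hK0.le).symm
    simp only [integral_const, probReal_univ, Finset.sum_const, Nat.card_Icc, smul_eq_mul,
      nsmul_eq_mul, Nat.add_sub_cancel, hη]
    rw [hsq, Real.sqrt_mul_self hsK.le]
    field_simp
    norm_num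
  have hmain : ∫ ω, ((n : ℝ)⁻¹ * ∑ i ∈ Finset.Icc 1 n, (f i (x K ω) - f i u)) ∂μpr
      ≤ 20 * D * G / √(K : ℝ) := by
    by_cases hint : Integrable
        (fun ω => (n : ℝ)⁻¹ * ∑ i ∈ Finset.Icc 1 n, (f i (x K ω) - f i u)) μpr
    swap
    · rw [integral_undef hint]; positivity
    have hsub : ∀ᵐ ω ∂μpr, ∀ i ∈ Finset.Icc 1 n, ∀ t ∈ Finset.Icc 1 K, ∀ u ∈ W,
        f i (x t ω) + ⟪ghat i t ω, u - x t ω⟫ ≤ f i u :=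
      (Finset.eventually_all _).2 fun i hi =>
        (Finset.eventually_all _).2 fun t ht => hsubgrad i hi t ht
    have hpt : ∀ᵐ ω ∂μpr, (n : ℝ)⁻¹ * ∑ i ∈ Finset.Icc 1 n, (f i (x K ω) - f i u)
        ≤ (n : ℝ)⁻¹ * ∑ i ∈ Finset.Icc 1 n,
          (K : ℝ)⁻¹ * ∑ t ∈ Finset.Icc 1 K, ⟪ghat i t ω, w t ω - u⟫ := by
      filter_upwards [hsub] with ω hω
      gcongr with i hi
      rw [le_inv_mul_iff₀ hK0]
      exact anytime_online_to_batch hWconv (f i) (fun t => w t ω) (fun t => x t ω)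
        (fun t => ghat i t ω) K (fun t ht => hwW t ht ω) (fun t ht => hxdef t ht ω)
        (hω i hi) hu
    have hI1 : ∀ i ∈ Finset.Icc 1 n, ∀ t ∈ Finset.Icc 1 K,
        Integrable (fun ω => ⟪ghat i t ω, w t ω - u⟫) μpr :=
      fun i hi t ht => hinnerint t ht _ (hghatint i hi t ht)
    have hI2 : ∀ i ∈ Finset.Icc 1 n, Integrable
        (fun ω => (K : ℝ)⁻¹ * ∑ t ∈ Finset.Icc 1 K, ⟪ghat i t ω, w t ω - u⟫) μpr :=
      fun i hi => (integrable_finsetSum _ (hI1 i hi)).const_mul _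
    refine (integral_mono_ae hint ((integrable_finsetSum _ hI2).const_mul _) hpt).trans ?_
    have heq : ∫ ω, (n : ℝ)⁻¹ * ∑ i ∈ Finset.Icc 1 n,
          (K : ℝ)⁻¹ * ∑ t ∈ Finset.Icc 1 K, ⟪ghat i t ω, w t ω - u⟫ ∂μpr
        = (K : ℝ)⁻¹ * ∑ t ∈ Finset.Icc 1 K, ∫ ω, ⟪gbar t ω, w t ω - u⟫ ∂μpr := by
      have h1 : ∀ t ∈ Finset.Icc 1 K, ∫ ω, ⟪gbar t ω, w t ω - u⟫ ∂μpr
          = (n : ℝ)⁻¹ * ∑ i ∈ Finset.Icc 1 n, ∫ ω, ⟪g i t ω, w t ω - u⟫ ∂μpr := by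
        intro t ht
        rw [← integral_finsetSum _ fun i hi => hinnerint t ht _ (hgint i hi t ht),
          ← integral_const_mul]
        simp only [hgbar, real_inner_smul_left, sum_inner]
      rw [Finset.sum_congr rfl h1, integral_const_mul, integral_finsetSum _ hI2,
        ← Finset.mul_sum, Finset.sum_comm, mul_left_comm,
        Finset.mul_sum (Finset.Icc 1 n) _ (K : ℝ)⁻¹]
      congr 1
      refine Finset.sum_congr rfl fun i hi => ?_
      rw [integral_const_mul, integral_finsetSum _ (hI1 i hi),
        Finset.sum_congr rfl (hunbiased i hi)]
    rw [heq, inv_mul_le_iff₀ hK0]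
    refine hregret.trans ?_
    have h2 : (K : ℝ) * (20 * D * G / √(K : ℝ)) = 20 * D * G * √(K : ℝ) := by
      have hsq : (K : ℝ) = √(K : ℝ) * √(K : ℝ) := (Real.mul_self_sqrt hK0.le).symm
      field_simp
      rw [sq, ← hsq]
    rw [h2]
    gcongr
    norm_num
  refine ⟨hmain, hmain.trans ?_⟩
  have hL1 : 1 ≤ δ * L := by
    have := Nat.le_ceil (1 / δ)
    rw [div_le_iff₀ hδ0, mul_comm] at this
    rwa [hL]
  have hL2 : δ * L ≤ 2 := by
    have h1 := Nat.ceil_lt_add_one (a := 1 / δ) (by positivity)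
    rw [← hL] at h1
    calc δ * L ≤ δ * (1 / δ + 1) := by gcongr
      _ = 1 + δ := by field_simp
      _ ≤ 2 := by linarith
  have hsqrt : √(δ * ((K : ℝ) * L)) ≤ 29 / 20 * √(K : ℝ) := by
    rw [Real.sqrt_le_left (by positivity), mul_pow, Real.sq_sqrt hK0.le]
    nlinarith
  have hpos : 0 < √(δ * ((K : ℝ) * L)) := Real.sqrt_pos.2 (by nlinarith)
  rw [div_le_div_iff₀ hsK hpos]
  calc 20 * D * G * √(δ * ((K : ℝ) * L)) ≤ 20 * D * G * (29 / 20 * √(K : ℝ)) := by gcongr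
    _ = 29 * D * G * √(K : ℝ) := by ring
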